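/- arXiv:2412.01494 — 7 statements merged into one kernel-verified Lean document; each statement's English description precedes it below -/
import Mathlib

section
/- Let R be a commutative ring, let q ≥ 1 and 1 ≤ N ≤ q, and let A, B ∈ M_q(R). Fix i ∈ {1,…,N}; define A_i ∈ M_q(R) by (A_i)_{jk} = A_{jk} if both j, k ∈ {i} ∪ {N+1,…,q} and 0 otherwise, set A_i^⋄ := A − A_i, and let γ_{i,0}, …, γ_{i,q+1−N} ∈ R with γ_{i,q+1−N} = 1 be the coefficients such that the monic characteristic polynomial of A_i equals X^{N−1} · Σ_{k=0}^{q+1−N} γ_{i,k} X^k. Then for all sequences m, e : ℕ → R^q satisfying m^{n+1} = A m^n + B e^n for every n, and for every n ≥ q − N, the i-th component satisfies the multi-step recursion m_i^{n+1} = − Σ_{k=0}^{q−N} γ_{i,k} · m_i^{n−q+N+k} + Σ_{k=0}^{q−N} [ ( Σ_{l=0}^{k} γ_{i,q+1−N+l−k} · A_i^l ) ( A_i^⋄ m^{n−k} + B e^{n−k} ) ]_i, where [v]_i denotes the i-th component of a vector v. -/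
open Matrix Polynomial

theorem Matrix.sum_smul_mulVec_of_recursion {R ι : Type*} [CommRing R] [Fintype ι] [DecidableEq ι]
    (M : Matrix ι ι R) (m u : ℕ → ι → R) (hm : ∀ n, m (n + 1) = M *ᵥ m n + u n)
    (γ : ℕ → R) (s d : ℕ) :
    ∑ k ∈ Finset.range (d + 1), γ k • m (s + k) =
      (∑ k ∈ Finset.range (d + 1), γ k • M ^ k) *ᵥ m s +
      ∑ k ∈ Finset.range d,
        (∑ l ∈ Finset.range (k + 1), γ (d + l - k) • M ^ l) *ᵥ u (s + d - 1 - k) := by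
  have iterate (d : ℕ) : m (s + d) = M ^ d *ᵥ m s +
      ∑ k ∈ Finset.range d, M ^ k *ᵥ u (s + d - 1 - k) := by
    induction d with
    | zero => simp
    | succ d ih =>
      rw [← add_assoc, hm, ih, Finset.sum_range_succ', mulVec_add, mulVec_mulVec, ← pow_succ',
        mulVec_sum, add_assoc]
      congr 2
      · refine Finset.sum_congr rfl fun k _ => ?_
        rw [mulVec_mulVec, ← pow_succ', show s + d + 1 - 1 - (k + 1) = s + d - 1 - k by omega]
      · simp
  induction d with
  | zero => simp [smul_mulVec]
  | succ d ih =>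
    have split : ∑ k ∈ Finset.range (d + 1),
        (∑ l ∈ Finset.range (k + 1), γ (d + 1 + l - k) • M ^ l) *ᵥ u (s + (d + 1) - 1 - k) =
        ∑ k ∈ Finset.range d,
          (∑ l ∈ Finset.range (k + 1), γ (d + l - k) • M ^ l) *ᵥ u (s + d - 1 - k) +
        γ (d + 1) • ∑ k ∈ Finset.range (d + 1), M ^ k *ᵥ u (s + (d + 1) - 1 - k) := by
      rw [Finset.sum_range_succ', Finset.sum_range_succ' (fun k => M ^ k *ᵥ _), smul_add,
        Finset.smul_sum, ← add_assoc (Finset.sum _ _), ← Finset.sum_add_distrib]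
      congr 1
      · refine Finset.sum_congr rfl fun k _ => ?_
        rw [Finset.sum_range_succ, add_mulVec, smul_mulVec,
          show s + (d + 1) - 1 - (k + 1) = s + d - 1 - k by omega,
          show d + 1 + (k + 1) - (k + 1) = d + 1 by omega]
        congr 2
        refine Finset.sum_congr rfl fun l _ => ?_
        rw [show d + 1 + l - (k + 1) = d + l - k by omega]
      · simp [smul_mulVec]
    rw [Finset.sum_range_succ, ih, split, Finset.sum_range_succ (fun k => γ k • M ^ k) (d + 1),
      add_mulVec, smul_mulVec, iterate (d + 1), smul_add]
    abel

theorem Matrix.aeval_fromBlocks_diagonal {R ι κ : Type*} [CommRing R] [Fintype ι] [DecidableEq ι]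
    [Fintype κ] [DecidableEq κ] (M : Matrix ι ι R) (D : Matrix κ κ R) (p : R[X]) :
    aeval (fromBlocks M 0 0 D) p = fromBlocks (aeval M p) 0 0 (aeval D p) := by
  induction p using Polynomial.induction_on' with
  | add p q hp hq => simp [hp, hq, fromBlocks_add]
  | monomial k a =>
    simp [aeval_monomial, fromBlocks_diagonal_pow, ← Algebra.smul_def, fromBlocks_smul]

/-- A matrix supported on the principal block indexed by `s` has characteristic polynomial
`X ^ c * p`, where `c` is the size of the complement of `s`, and the rows of `p(M)` indexed by `s`
vanish. -/
theorem Matrix.aeval_apply_eq_zero_of_charpoly_eq {R ι : Type*} [CommRing R] [Fintype ι]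
    [DecidableEq ι] (s : ι → Prop) [DecidablePred s] (M : Matrix ι ι R)
    (hM : ∀ j k, ¬(s j ∧ s k) → M j k = 0) (p : R[X])
    (hp : M.charpoly = X ^ Fintype.card {j // ¬s j} * p) (i j : ι) (hi : s i) :
    aeval M p i j = 0 := by
  let e := Equiv.sumCompl s
  let S : Matrix {j // s j} {j // s j} R := M.submatrix (↑) (↑)
  have hS : reindex e.symm e.symm M = fromBlocks S 0 0 0 := by
    ext (a | a) (b | b)
    · rfl
    · exact hM _ _ fun h => b.2 h.2
    · exact hM _ _ fun h => a.2 h.1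
    · exact hM _ _ fun h => a.2 h.1
  have hSp : S.charpoly = p := by
    have h := charpoly_reindex e.symm M
    rw [hS, charpoly_fromBlocks_zero₁₂, charpoly_zero, hp, mul_comm] at h
    exact (monic_X_pow _).isRegular.left h
  have h : reindexAlgEquiv R R e.symm (aeval M p) = fromBlocks 0 0 0 (aeval 0 p) := by
    rw [← AlgEquiv.coe_toAlgHom, ← aeval_algHom_apply, AlgEquiv.coe_toAlgHom, coe_reindexAlgEquiv,
      hS, aeval_fromBlocks_diagonal, ← hSp, aeval_self_charpoly]
  have h' := congrFun (congrFun h (Sum.inl ⟨i, hi⟩)) (e.symm j)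
  rw [coe_reindexAlgEquiv, reindex_apply, submatrix_apply] at h'
  simp only [Equiv.symm_symm, Equiv.apply_symm_apply] at h'
  refine Eq.trans h' ?_
  rcases e.symm j with b | b <;> rfl

theorem Fin.card_subtype_not_eq_or_le {q N : ℕ} (hNq : N ≤ q) (i : Fin q) (hi : (i : ℕ) < N) :
    Fintype.card {j : Fin q // ¬(j = i ∨ N ≤ (j : ℕ))} = N - 1 := by
  have h : Finset.univ.filter (fun j : Fin q => ¬(j = i ∨ N ≤ (j : ℕ))) =
      (Finset.univ.map (Fin.castLEEmb hNq)).erase i := by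
    ext j
    simp only [Finset.mem_filter, Finset.mem_univ, true_and, Finset.mem_erase, Finset.mem_map,
      not_or, not_le]
    refine and_congr_right fun _ => ⟨fun h => ⟨⟨j, h⟩, rfl⟩, ?_⟩
    rintro ⟨a, rfl⟩
    exact a.2
  rw [Fintype.card_subtype, h, Finset.card_erase_of_mem, Finset.card_map, Finset.card_univ,
    Fintype.card_fin]
  exact Finset.mem_map.2 ⟨⟨i, hi⟩, Finset.mem_univ _, rfl⟩

/-- Corresponding finite difference scheme of a lattice Boltzmann scheme
`m^{n+1} = A m^n + B e^n` with `N` conserved moments: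
the `i`-th conserved component satisfies a multi-step recursion whose coefficients
`γ_{i,k}` are those of the characteristic polynomial of `A_i`
(written as `χ_{A_i} = X^(N-1) ⬝ Σ_{k=0}^{q+1-N} γ_{i,k} X^k`). -/
theorem stmt_1 {R : Type*} [CommRing R] (q N : ℕ) (hq : 1 ≤ q) (hN1 : 1 ≤ N) (hNq : N ≤ q)
    (A B : Matrix (Fin q) (Fin q) R) (i : Fin q) (hi : (i : ℕ) < N)
    (Ai : Matrix (Fin q) (Fin q) R)
    (hAi : Ai = Matrix.of fun j k : Fin q =>
      if (j = i ∨ N ≤ (j : ℕ)) ∧ (k = i ∨ N ≤ (k : ℕ)) then A j k else 0)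
    (γ : ℕ → R) (hγtop : γ (q + 1 - N) = 1)
    (hχ : Ai.charpoly = X ^ (N - 1) * ∑ k ∈ Finset.range (q + 2 - N), C (γ k) * X ^ k)
    (m e : ℕ → Fin q → R)
    (hm : ∀ n, m (n + 1) = A *ᵥ m n + B *ᵥ e n)
    (n : ℕ) (hn : q - N ≤ n) :
    m (n + 1) i =
      - ∑ k ∈ Finset.range (q - N + 1), γ k * m (n + N + k - q) i
      + ∑ k ∈ Finset.range (q - N + 1),
          ((∑ l ∈ Finset.range (k + 1), γ (q + 1 - N + l - k) • Ai ^ l) *ᵥ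
            ((A - Ai) *ᵥ m (n - k) + B *ᵥ e (n - k))) i := by
  obtain ⟨d, rfl⟩ := Nat.exists_eq_add_of_le hNq
  obtain ⟨s, rfl⟩ := Nat.exists_eq_add_of_le hn
  rw [show N + d + 1 - N = d + 1 by omega] at hγtop ⊢
  rw [show N + d + 2 - N = d + 1 + 1 by omega] at hχ
  rw [show N + d - N = d by omega]
  have row (j : Fin (N + d)) : (∑ k ∈ Finset.range (d + 1 + 1), γ k • Ai ^ k) i j = 0 := by
    have h := aeval_apply_eq_zero_of_charpoly_eq (fun j : Fin (N + d) => j = i ∨ N ≤ (j : ℕ)) Ai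
      (fun j k h => by rw [hAi, of_apply, if_neg h]) _
      (by rw [Fin.card_subtype_not_eq_or_le hNq i hi]; exact hχ) i j (Or.inl rfl)
    simpa [map_sum, ← Algebra.smul_def] using h
  have main := congrFun (sum_smul_mulVec_of_recursion Ai m
    (fun n => (A - Ai) *ᵥ m n + B *ᵥ e n)
    (fun n => by rw [hm, sub_mulVec]; abel) γ s (d + 1)) i
  have hrow : ((∑ k ∈ Finset.range (d + 1 + 1), γ k • Ai ^ k) *ᵥ m s) i = 0 := by
    simp only [mulVec, dotProduct, row, zero_mul, Finset.sum_const_zero]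
  rw [Pi.add_apply, hrow, zero_add, Finset.sum_range_succ, hγtop, one_smul, Pi.add_apply,
    Finset.sum_apply, Finset.sum_apply, ← add_assoc, Nat.add_sub_cancel] at main
  rw [add_comm d s, neg_add_eq_sub, eq_sub_iff_add_eq']
  convert main using 3 with k hk
  rw [Pi.smul_apply, smul_eq_mul, show s + d + N + k - (N + d) = s + k by omega]
end

section
/- Let R be a commutative ring, let A, B ∈ M₃(R), and write the monic characteristic polynomial of A as χ_A(λ) = det(λI − A) = λ³ + γ₂λ² + γ₁λ + γ₀. Then for all sequences m, e : ℕ → R³ satisfying m^{n+1} = A m^n + B e^n for every n, and for every n ≥ 2, the first component satisfies m₁^{n+1} = −γ₀ m₁^{n−2} − γ₁ m₁^{n−1} − γ₂ m₁^{n} + [ B e^n + (γ₂ I + A) B e^{n−1} + (γ₁ I + γ₂ A + A²) B e^{n−2} ]₁, where [v]₁ denotes the first component of a vector v. -/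
open Matrix Polynomial

/-- Corresponding finite difference scheme of a D₁Q₃ lattice Boltzmann scheme
`m^{n+1} = A m^n + B e^n` with one conserved moment: the first component satisfies
a three-step recursion whose coefficients come from `χ_A = λ³ + γ₂λ² + γ₁λ + γ₀`. -/
theorem stmt_2 {R : Type*} [CommRing R] (A B : Matrix (Fin 3) (Fin 3) R)
    (γ₀ γ₁ γ₂ : R)
    (hχ : A.charpoly = X ^ 3 + C γ₂ * X ^ 2 + C γ₁ * X + C γ₀)
    (m e : ℕ → Fin 3 → R)
    (hm : ∀ n, m (n + 1) = A *ᵥ m n + B *ᵥ e n)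
    (n : ℕ) (hn : 2 ≤ n) :
    m (n + 1) 0 =
      -γ₀ * m (n - 2) 0 - γ₁ * m (n - 1) 0 - γ₂ * m n 0
      + ((B *ᵥ e n
          + (γ₂ • (1 : Matrix (Fin 3) (Fin 3) R) + A) *ᵥ (B *ᵥ e (n - 1))
          + (γ₁ • (1 : Matrix (Fin 3) (Fin 3) R) + γ₂ • A + A ^ 2) *ᵥ (B *ᵥ e (n - 2))
          : Fin 3 → R)) 0 := by
  obtain ⟨k, rfl⟩ := Nat.exists_eq_add_of_le' hn
  have cayley_hamilton : A ^ 3 + γ₂ • A ^ 2 + γ₁ • A + γ₀ • (1 : Matrix (Fin 3) (Fin 3) R) = 0 := by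
    have h := A.aeval_self_charpoly
    rw [hχ] at h
    simpa [Algebra.algebraMap_eq_smul_one] using h
  have key := congrFun (congrArg (· *ᵥ m k) cayley_hamilton) 0
  have h₁ : k + 2 - 1 = k + 1 := rfl
  rw [h₁, Nat.add_sub_cancel, hm (k + 2), hm (k + 1), hm k]
  simp only [pow_succ, pow_zero, one_mul, add_mulVec, smul_mulVec, one_mulVec, zero_mulVec,
    ← mulVec_mulVec, mulVec_add, Pi.add_apply, Pi.smul_apply, Pi.zero_apply, smul_eq_mul] at key ⊢
  linear_combination key
end

section
/- Let R be a commutative ring, let T = (t_{ij}), T̃ = (t̃_{ij}) ∈ M₃(R), let S = diag(0,2,2), and set A := T(I−S), B := TS, Ã := T̃(I−S), B̃ := T̃S. Assume: (1) t₁₂ = t̃₁₂ and t₁₃ = t̃₁₃; (2) t₁₁t₁₂ − t₁₂t₂₂ − t₁₃t₃₂ = t̃₁₁t̃₁₂ − t̃₁₂t̃₂₂ − t̃₁₃t̃₃₂ and t₁₁t₁₃ − t₁₂t₂₃ − t₁₃t₃₃ = t̃₁₁t̃₁₃ − t̃₁₂t̃₂₃ − t̃₁₃t̃₃₃; (3)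 with 𝔞₁ = t₁₁² − t₁₂t₂₁ − t₁₃t₃₁, 𝔞₂ = −t₁₁t₁₂ + t₁₂t₂₂ + t₁₃t₃₂, 𝔞₃ = −t₁₁t₁₃ + t₁₂t₂₃ + t₁₃t₃₃ and the analogous 𝔞̃ᵢ for T̃, one has 𝔞₁t₁₂ + 𝔞₂t₂₂ + 𝔞₃t₃₂ = 𝔞̃₁t̃₁₂ + 𝔞̃₂t̃₂₂ + 𝔞̃₃t̃₃₂ and 𝔞₁t₁₃ + 𝔞₂t₂₃ + 𝔞₃t₃₃ = 𝔞̃₁t̃₁₃ + 𝔞̃₂t̃₂₃ + 𝔞̃₃t̃₃₃; (4) the characteristic polynomials of A and Ã coincide, with common coefficients χ_A(λ) = λ³ + γ₂λ² + γ₁λ + γ₀. Then for all u₀, u₁, u₂ ∈ R and all w₀, w₁, w₂ ∈ R³: −γ₀u₀ − γ₁u₁ − γ₂u₂ + [ B w₂ + (γ₂I + A) B w₁ + (γ₁I + γ₂A + A²) B w₀ ]₁ = −γ₀u₀ − γ₁u₁ − γ₂u₂ + [ B̃ w₂ + (γ₂I + Ã) B̃ w₁ + (γ₁I + γ₂Ã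 + Ã²) B̃ w₀ ]₁; that is, the two lattice Boltzmann schemes induce the identical three-step finite difference scheme on the conserved moment, even when T ≠ T̃. -/
open Matrix Polynomial

/-- Two D₁Q₃ lattice Boltzmann schemes given by `T`, `T̃` with `S = diag(0,2,2)`,
`A = T(I−S)`, `B = TS`, `Ã = T̃(I−S)`, `B̃ = T̃S`, satisfying conditions (1)–(4)
(coinciding first rows of `B` and `B̃`, of `AB` and `ÃB̃`, of `A²B` and `Ã²B̃`, via the
explicit entry formulas, and equal characteristic polynomials) induce the identical
three-step finite difference right-hand side on the conserved moment. -/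
theorem stmt_8 {R : Type*} [CommRing R] (T T' : Matrix (Fin 3) (Fin 3) R)
    (γ₀ γ₁ γ₂ : R)
    -- condition (1)
    (h1a : T 0 1 = T' 0 1) (h1b : T 0 2 = T' 0 2)
    -- condition (2)
    (h2a : T 0 0 * T 0 1 - T 0 1 * T 1 1 - T 0 2 * T 2 1
         = T' 0 0 * T' 0 1 - T' 0 1 * T' 1 1 - T' 0 2 * T' 2 1)
    (h2b : T 0 0 * T 0 2 - T 0 1 * T 1 2 - T 0 2 * T 2 2
         = T' 0 0 * T' 0 2 - T' 0 1 * T' 1 2 - T' 0 2 * T' 2 2)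
    -- condition (3)
    (h3a : (T 0 0 ^ 2 - T 0 1 * T 1 0 - T 0 2 * T 2 0) * T 0 1
         + (-(T 0 0 * T 0 1) + T 0 1 * T 1 1 + T 0 2 * T 2 1) * T 1 1
         + (-(T 0 0 * T 0 2) + T 0 1 * T 1 2 + T 0 2 * T 2 2) * T 2 1
         = (T' 0 0 ^ 2 - T' 0 1 * T' 1 0 - T' 0 2 * T' 2 0) * T' 0 1
         + (-(T' 0 0 * T' 0 1) + T' 0 1 * T' 1 1 + T' 0 2 * T' 2 1) * T' 1 1
         + (-(T' 0 0 * T' 0 2) + T' 0 1 * T' 1 2 + T' 0 2 * T' 2 2) * T' 2 1)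
    (h3b : (T 0 0 ^ 2 - T 0 1 * T 1 0 - T 0 2 * T 2 0) * T 0 2
         + (-(T 0 0 * T 0 1) + T 0 1 * T 1 1 + T 0 2 * T 2 1) * T 1 2
         + (-(T 0 0 * T 0 2) + T 0 1 * T 1 2 + T 0 2 * T 2 2) * T 2 2
         = (T' 0 0 ^ 2 - T' 0 1 * T' 1 0 - T' 0 2 * T' 2 0) * T' 0 2
         + (-(T' 0 0 * T' 0 1) + T' 0 1 * T' 1 1 + T' 0 2 * T' 2 1) * T' 1 2
         + (-(T' 0 0 * T' 0 2) + T' 0 1 * T' 1 2 + T' 0 2 * T' 2 2) * T' 2 2)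
    -- condition (4): equal characteristic polynomials with common coefficients
    (h4 : (T * (1 - (Matrix.diagonal ![0, 2, 2] : Matrix (Fin 3) (Fin 3) R))).charpoly
        = X ^ 3 + C γ₂ * X ^ 2 + C γ₁ * X + C γ₀)
    (h4' : (T' * (1 - (Matrix.diagonal ![0, 2, 2] : Matrix (Fin 3) (Fin 3) R))).charpoly
        = X ^ 3 + C γ₂ * X ^ 2 + C γ₁ * X + C γ₀)
    (u₀ u₁ u₂ : R) (w₀ w₁ w₂ : Fin 3 → R) :
    let S : Matrix (Fin 3) (Fin 3) R := Matrix.diagonal ![0, 2, 2]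
    let A : Matrix (Fin 3) (Fin 3) R := T * (1 - S)
    let B : Matrix (Fin 3) (Fin 3) R := T * S
    let A' : Matrix (Fin 3) (Fin 3) R := T' * (1 - S)
    let B' : Matrix (Fin 3) (Fin 3) R := T' * S
    (-γ₀ * u₀ - γ₁ * u₁ - γ₂ * u₂
      + ((B *ᵥ w₂
          + (γ₂ • (1 : Matrix (Fin 3) (Fin 3) R) + A) *ᵥ (B *ᵥ w₁)
          + (γ₁ • (1 : Matrix (Fin 3) (Fin 3) R) + γ₂ • A + A ^ 2) *ᵥ (B *ᵥ w₀)
          : Fin 3 → R)) 0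
    = -γ₀ * u₀ - γ₁ * u₁ - γ₂ * u₂
      + ((B' *ᵥ w₂
          + (γ₂ • (1 : Matrix (Fin 3) (Fin 3) R) + A') *ᵥ (B' *ᵥ w₁)
          + (γ₁ • (1 : Matrix (Fin 3) (Fin 3) R) + γ₂ • A' + A' ^ 2) *ᵥ (B' *ᵥ w₀)
          : Fin 3 → R)) 0) := by
  intro S A B A' B'
  simp only [S, A, B, A', B', sq, Matrix.mulVec, dotProduct, Matrix.mul_apply, Matrix.add_apply,
    Matrix.sub_apply, Matrix.smul_apply, Pi.add_apply, Fin.sum_univ_three]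
  simp
  linear_combination
    2 * (w₂ 1 + γ₂ * w₁ 1 + γ₁ * w₀ 1) * h1a + 2 * (w₂ 2 + γ₂ * w₁ 2 + γ₁ * w₀ 2) * h1b
    + 2 * (w₁ 1 + γ₂ * w₀ 1) * h2a + 2 * (w₁ 2 + γ₂ * w₀ 2) * h2b
    + 2 * w₀ 1 * h3a + 2 * w₀ 2 * h3b
end

section
/- Let R = ℝ[x, x⁻¹] be the ring of Laurent polynomials over ℝ (with x the elementary shift operator). There exist invertible real 2×2 matrices M and M̃ — for instance M = [[1,1],[1,−1]] and M̃ = [[2,1],[2,0]] — such that T := M·diag(x, x⁻¹)·M⁻¹ and T̃ := M̃·diag(x, x⁻¹)·M̃⁻¹ are distinct elements of M₂(R), yet for every s ∈ ℝ, taking S = diag(0, s), ε = 1 and C = [[ε,0],[ε,0]], the evolution matrices E := T(I − S) + T S C and Ẽ := T̃(I − S) + T̃ S C have the same characteristic polynomial, namely tr(E) = tr(Ẽ) and det(E) = det(Ẽ). Consequently two distinct lattice Boltzmann schemes (with distinct moment matrices M ≠ M̃) give rise to the same finite difference scheme on the conserved moment, so the lattice Boltzmann scheme cannot be uniquely recovered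 from the finite difference scheme. -/
open Matrix LaurentPolynomial

/-- `T(M) = M ⬝ diag(x, x⁻¹) ⬝ M⁻¹` over the Laurent polynomial ring `ℝ[x,x⁻¹]`,
for a real moment matrix `M` (`x` is the elementary shift operator). -/
noncomputable def Tmat (M : Matrix (Fin 2) (Fin 2) ℝ) :
    Matrix (Fin 2) (Fin 2) (LaurentPolynomial ℝ) :=
  M.map (algebraMap ℝ (LaurentPolynomial ℝ)) *
    Matrix.diagonal ![LaurentPolynomial.T 1, LaurentPolynomial.T (-1)] *
    (M.map (algebraMap ℝ (LaurentPolynomial ℝ)))⁻¹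

/-- Evolution matrix `E = T(M)(I − S) + T(M) S C` of the D₁Q₂ lattice Boltzmann scheme
with `S = diag(0, s)` and `C = [[ε,0],[ε,0]]`, `ε = 1`. -/
noncomputable def Emat (M : Matrix (Fin 2) (Fin 2) ℝ) (s : ℝ) :
    Matrix (Fin 2) (Fin 2) (LaurentPolynomial ℝ) :=
  Tmat M * (1 - Matrix.diagonal ![0, algebraMap ℝ (LaurentPolynomial ℝ) s]) +
    Tmat M * Matrix.diagonal ![0, algebraMap ℝ (LaurentPolynomial ℝ) s] * !![1, 0; 1, 0]

theorem inv_map_algebraMap_eq {R A n : Type*} [CommRing R] [CommRing A] [Algebra R A]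
    [Fintype n] [DecidableEq n] {M N : Matrix n n R} (h : M * N = 1) :
    (M.map (algebraMap R A))⁻¹ = N.map (algebraMap R A) := by
  apply Matrix.inv_eq_right_inv
  rw [← Matrix.map_mul, h, Matrix.map_one _ (map_zero _) (map_one _)]

theorem Tmat_of_mul_eq_one {a b c d a' b' c' d' : ℝ}
    (h : !![a, b; c, d] * !![a', b'; c', d'] = 1) :
    Tmat !![a, b; c, d] =
      !![C (a * a') * T 1 + C (b * c') * T (-1), C (a * b') * T 1 + C (b * d') * T (-1);
         C (c * a') * T 1 + C (d * c') * T (-1), C (c * b') * T 1 + C (d * d') * T (-1)] := by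
  rw [Tmat, inv_map_algebraMap_eq h]
  ext1 i j
  fin_cases i <;> fin_cases j <;>
    simp [Matrix.mul_apply, Fin.sum_univ_two, Matrix.diagonal] <;>
    ring

theorem Emat_eq_mul (M : Matrix (Fin 2) (Fin 2) ℝ) (s : ℝ) :
    Emat M s = Tmat M * !![1, 0; C s, 1 - C s] := by
  rw [Emat, Matrix.mul_assoc, ← Matrix.mul_add]
  congr 1
  ext1 i j
  fin_cases i <;> fin_cases j <;>
    simp [Matrix.mul_apply, Matrix.diagonal, LaurentPolynomial.algebraMap_apply]

theorem det_Tmat {M : Matrix (Fin 2) (Fin 2) ℝ} (hM : IsUnit M.det) : (Tmat M).det = 1 := by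
  have hu : IsUnit (M.map (algebraMap ℝ (LaurentPolynomial ℝ))) := by
    rw [← RingHom.mapMatrix_apply]
    exact ((Matrix.isUnit_iff_isUnit_det M).2 hM).map _
  rw [Tmat, Matrix.det_conj hu, Matrix.det_diagonal]
  rw [Fin.prod_univ_two, Matrix.cons_val_zero, Matrix.cons_val_one, Matrix.cons_val_fin_one,
    ← LaurentPolynomial.T_add, add_neg_cancel, LaurentPolynomial.T_zero]

theorem det_Emat {M : Matrix (Fin 2) (Fin 2) ℝ} (hM : IsUnit M.det) (s : ℝ) :
    (Emat M s).det = 1 - C s := by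
  simp [Emat_eq_mul, det_Tmat hM, Matrix.det_fin_two]

theorem trace_Emat (M : Matrix (Fin 2) (Fin 2) ℝ) (s : ℝ) :
    (Emat M s).trace = (Tmat M).trace + C s * (Tmat M 0 1 - Tmat M 1 1) := by
  simp [Emat_eq_mul, Matrix.trace_fin_two, Matrix.mul_apply, Fin.sum_univ_two]
  ring

/-- There exist two distinct invertible real moment matrices `M ≠ M̃` with distinct
`T(M) ≠ T(M̃)` such that for every relaxation rate `s`, the evolution matrices of the two
D₁Q₂ lattice Boltzmann schemes have the same characteristic polynomial (same trace and
determinant); hence the lattice Boltzmann scheme cannot be uniquely recovered from the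
finite difference scheme. -/
theorem stmt_9 :
    ∃ M M' : Matrix (Fin 2) (Fin 2) ℝ, IsUnit M.det ∧ IsUnit M'.det ∧ M ≠ M' ∧
      Tmat M ≠ Tmat M' ∧
      ∀ s : ℝ, (Emat M s).trace = (Emat M' s).trace ∧ (Emat M s).det = (Emat M' s).det := by
  have h₁ : Tmat !![1, 1; 1, -1] = _ :=
    Tmat_of_mul_eq_one (a' := 1 / 2) (b' := 1 / 2) (c' := 1 / 2) (d' := -1 / 2) (by
      ext i j; fin_cases i <;> fin_cases j <;> norm_num [Matrix.mul_apply, Fin.sum_univ_two])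
  have h₂ : Tmat !![2, 1; 2, 0] = _ :=
    Tmat_of_mul_eq_one (a' := 0) (b' := 1 / 2) (c' := 1) (d' := -1) (by
      ext i j; fin_cases i <;> fin_cases j <;> norm_num [Matrix.mul_apply, Fin.sum_univ_two])
  have hu₁ : IsUnit (!![1, 1; 1, -1] : Matrix (Fin 2) (Fin 2) ℝ).det := by
    norm_num [Matrix.det_fin_two]
  have hu₂ : IsUnit (!![2, 1; 2, 0] : Matrix (Fin 2) (Fin 2) ℝ).det := by
    norm_num [Matrix.det_fin_two]
  have hT : Tmat !![1, 1; 1, -1] ≠ Tmat !![2, 1; 2, 0] := by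
    intro h
    have h₁₀ := congrFun (congrFun h 1) 0
    rw [h₁, h₂] at h₁₀
    have hcoeff := DFunLike.congr_fun (congrArg AddMonoidAlgebra.coeff h₁₀) (1 : ℤ)
    simp [← LaurentPolynomial.single_eq_C_mul_T] at hcoeff
  refine ⟨!![1, 1; 1, -1], !![2, 1; 2, 0], hu₁, hu₂, fun h => hT (congrArg Tmat h), hT,
    fun s => ⟨?_, by rw [det_Emat hu₁, det_Emat hu₂]⟩⟩
  have hhalf : (C (1 / 2) + C (1 / 2) : LaurentPolynomial ℝ) = 1 := by
    rw [← map_add, add_halves, map_one]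
  rw [trace_Emat, trace_Emat, h₁, h₂]
  simp [Matrix.trace_fin_two, neg_div] at hhalf ⊢
  linear_combination (T 1 + T (-1) - C s * T (-1)) * hhalf
end

section
/- Let R be a commutative ring in which 2 is invertible and let x ∈ R be a unit. Let M = [[1,1],[1,−1]] and let M̃ = [[a,b],[c,d]] ∈ M₂(R) with ad − bc invertible in R. Fix s, ε ∈ R, set S = diag(0, s), C = [[ε,0],[ε,0]], T := M·diag(x, x⁻¹)·M⁻¹, T̃ := M̃·diag(x, x⁻¹)·M̃⁻¹, E := T(I − S) + T S C, and Ẽ := T̃(I − S) + T̃ S C. If a·(εd + 2εb − d) = bc·(ε + 1) (equivalently ad + bc − 2εab = ε(ad − bc)), then tr(E) = tr(Ẽ) and det(E) = det(Ẽ), i.e. E and Ẽ have the same characteristic polynomial. -/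
open Matrix

/-- `det M` times the trace of the evolution matrix, for a moment matrix `!![a, b; c, d]`
and velocities `diag(x, y)`. -/
theorem det_mul_trace_evolution {R : Type*} [CommRing R] (a b c d x y s ε : R)
    (h : IsUnit (a * d - b * c)) :
    (a * d - b * c) *
        (!![a, b; c, d] * diagonal ![x, y] * !![a, b; c, d]⁻¹ * (1 - diagonal ![0, s]) +
          !![a, b; c, d] * diagonal ![x, y] * !![a, b; c, d]⁻¹ * diagonal ![0, s] *
            !![ε, 0; ε, 0]).trace =
      (a * d - b * c) * (x + y) + s * (b * c * x - a * d * y - ε * (a * b) * (x - y)) := by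
  have hu := Ring.mul_inverse_cancel _ h
  rw [inv_def, adjugate_fin_two_of, det_fin_two_of]
  generalize Ring.inverse (a * d - b * c) = u at hu ⊢
  simp [trace_fin_two, diagonal_vec2, one_fin_two]
  linear_combination
    ((a * d - b * c) * (x + y) + s * (b * c * x - a * d * y - ε * (a * b) * (x - y))) * hu

/-- The determinant of the evolution matrix does not depend on the moment matrix. -/
theorem det_evolution {n R : Type*} [Fintype n] [DecidableEq n] [CommRing R]
    (M D S C : Matrix n n R) (h : IsUnit M.det) :
    (M * D * M⁻¹ * (1 - S) + M * D * M⁻¹ * S * C).det = D.det * (1 - S + S * C).det := by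
  rw [Matrix.mul_assoc _ S C, ← Matrix.mul_add, det_mul,
    det_conj ((isUnit_iff_isUnit_det M).mpr h)]

/-- If the moment matrix `M̃ = [[a,b],[c,d]]` (invertible) satisfies the condition
`a(εd + 2εb − d) = bc(ε + 1)`, then the D₁Q₂ evolution matrices built from
`M = [[1,1],[1,−1]]` and `M̃` (with `T = M diag(x,x⁻¹) M⁻¹`, `S = diag(0,s)`,
`C = [[ε,0],[ε,0]]`, `E = T(I−S) + TSC`) have the same trace and determinant,
i.e. the same characteristic polynomial. -/
theorem stmt_10 {R : Type*} [CommRing R] (h2 : IsUnit (2 : R)) (x : Rˣ)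
    (a b c d s ε : R) (hdet : IsUnit (a * d - b * c))
    (hcond : a * (ε * d + 2 * ε * b - d) = b * c * (ε + 1)) :
    let M : Matrix (Fin 2) (Fin 2) R := !![1, 1; 1, -1]
    let M' : Matrix (Fin 2) (Fin 2) R := !![a, b; c, d]
    let D : Matrix (Fin 2) (Fin 2) R := Matrix.diagonal ![(x : R), ((x⁻¹ : Rˣ) : R)]
    let S : Matrix (Fin 2) (Fin 2) R := Matrix.diagonal ![0, s]
    let Cm : Matrix (Fin 2) (Fin 2) R := !![ε, 0; ε, 0]
    let T : Matrix (Fin 2) (Fin 2) R := M * D * M⁻¹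
    let T' : Matrix (Fin 2) (Fin 2) R := M' * D * M'⁻¹
    let E : Matrix (Fin 2) (Fin 2) R := T * (1 - S) + T * S * Cm
    let E' : Matrix (Fin 2) (Fin 2) R := T' * (1 - S) + T' * S * Cm
    E.trace = E'.trace ∧ E.det = E'.det := by
  intro M M' D S Cm T T' E E'
  have hM : IsUnit ((1 : R) * (-1) - 1 * 1) := by
    have := h2.neg
    rwa [show (1 : R) * (-1) - 1 * 1 = -2 by ring]
  constructor
  · have ht : _ * E.trace = _ :=
      det_mul_trace_evolution 1 1 1 (-1) (x : R) ((x⁻¹ : Rˣ) : R) s ε hM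
    have ht' : _ * E'.trace = _ :=
      det_mul_trace_evolution a b c d (x : R) ((x⁻¹ : Rˣ) : R) s ε hdet
    refine (hM.mul hdet).mul_left_cancel ?_
    linear_combination (a * d - b * c) * ht + 2 * ht' -
      s * ((x : R) - ((x⁻¹ : Rˣ) : R)) * hcond
  · have hd : E.det = _ := det_evolution M D S Cm (by rwa [det_fin_two_of])
    have hd' : E'.det = _ := det_evolution M' D S Cm (by rwa [det_fin_two_of])
    rw [hd, hd']
end

section
/- Let R be a commutative ring, let x ∈ R be a unit, and let M̃ ∈ M₂(R) be invertible. Fix s, ε ∈ R, set S = diag(0, s), C = [[ε,0],[ε,0]], T̃ := M̃·diag(x, x⁻¹)·M̃⁻¹, and Ẽ := T̃(I − S) + T̃ S C. Then det(Ẽ) = 1 − s. Moreover, if 2 is invertible in R and M = [[1,1],[1,−1]], then the corresponding evolution matrix E := T(I − S) + T S C with T = M·diag(x, x⁻¹)·M⁻¹ satisfies tr(E) = ((2 − s)(x + x⁻¹) + sε(x − x⁻¹))/2. -/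
open Matrix

/-- For any invertible moment matrix `M̃`, the D₁Q₂ evolution matrix
`Ẽ = T̃(I−S) + T̃SC` with `T̃ = M̃ diag(x,x⁻¹) M̃⁻¹`, `S = diag(0,s)`, `C = [[ε,0],[ε,0]]`
has determinant `1 − s`; and if `2` is invertible, the evolution matrix built from
`M = [[1,1],[1,−1]]` has trace `((2 − s)(x + x⁻¹) + sε(x − x⁻¹))/2`. -/
theorem stmt_11 {R : Type*} [CommRing R] (x : Rˣ)
    (M' : Matrix (Fin 2) (Fin 2) R) (hM' : IsUnit M'.det) (s ε : R) :
    let D : Matrix (Fin 2) (Fin 2) R := Matrix.diagonal ![(x : R), ((x⁻¹ : Rˣ) : R)]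
    let S : Matrix (Fin 2) (Fin 2) R := Matrix.diagonal ![0, s]
    let Cm : Matrix (Fin 2) (Fin 2) R := !![ε, 0; ε, 0]
    let T' : Matrix (Fin 2) (Fin 2) R := M' * D * M'⁻¹
    let M : Matrix (Fin 2) (Fin 2) R := !![1, 1; 1, -1]
    let T : Matrix (Fin 2) (Fin 2) R := M * D * M⁻¹
    ((T' * (1 - S) + T' * S * Cm).det = 1 - s ∧
      (IsUnit (2 : R) →
        (T * (1 - S) + T * S * Cm).trace
          = Ring.inverse (2 : R) *
              ((2 - s) * ((x : R) + ((x⁻¹ : Rˣ) : R)) + s * ε * ((x : R) - ((x⁻¹ : Rˣ) : R))))) := by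
  intro D S Cm T' M T
  have hL : 1 - S + S * Cm = !![1, 0; s * ε, 1 - s] := by
    ext i j
    fin_cases i <;> fin_cases j <;> simp [S, Cm]
  have hE (A : Matrix (Fin 2) (Fin 2) R) :
      A * (1 - S) + A * S * Cm = A * !![1, 0; s * ε, 1 - s] := by
    rw [← hL, mul_add, Matrix.mul_assoc A S Cm]
  rw [hE, hE]
  constructor
  · have hD : D.det = 1 := by simp [D]
    have hT : T'.det = 1 := by
      rw [det_mul_right_comm, mul_nonsing_inv _ hM', one_mul, hD]
    rw [det_mul, hT, det_fin_two_of]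
    ring
  · intro h2
    have hr : 2 * Ring.inverse (2 : R) = 1 := Ring.mul_inverse_cancel 2 h2
    have hM : M⁻¹ = Ring.inverse (2 : R) • M := by
      refine inv_eq_right_inv ?_
      have hMM : M * M = (2 : R) • 1 := by
        ext i j
        fin_cases i <;> fin_cases j <;> norm_num [M]
      rw [mul_smul_comm, hMM, smul_smul, mul_comm, hr, one_smul]
    have hD : D = !![(x : R), 0; 0, ((x⁻¹ : Rˣ) : R)] := by
      ext i j
      fin_cases i <;> fin_cases j <;> simp [D]
    have hT : T = Ring.inverse (2 : R) • (M * D * M) := by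
      simp only [T]
      rw [hM, mul_smul_comm]
    rw [hT, hD, smul_mul_assoc, trace_smul, smul_eq_mul]
    congr 1
    simp only [M, mul_fin_two, trace_fin_two_of]
    ring
end

section
/- Let R be a commutative ring and E ∈ M₂(R). Then every sequence m : ℕ → R² satisfying m^{n+1} = E m^n for all n also satisfies the two-step vector recursion m^{n+2} = tr(E)·m^{n+1} − det(E)·m^n for all n. Consequently, if Ẽ ∈ M₂(R) satisfies tr(Ẽ) = tr(E) and det(Ẽ) = det(E), and m̃ : ℕ → R² satisfies m̃^{n+1} = Ẽ m̃^n for all n with m₁⁰ = m̃₁⁰ and m₁¹ = m̃₁¹ (equality of the first components at times 0 and 1), then m₁ⁿ = m̃₁ⁿ for all n ∈ ℕ. -/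
open Matrix

/-- Cayley–Hamilton for `2 × 2` matrices, read along an orbit of `E`. -/
theorem orbit_two_step_recursion {R : Type*} [CommRing R] {E : Matrix (Fin 2) (Fin 2) R}
    {m : ℕ → Fin 2 → R} (hm : ∀ n, m (n + 1) = E *ᵥ m n) (n : ℕ) :
    m (n + 2) = E.trace • m (n + 1) - E.det • m n := by
  rw [hm (n + 1), hm n]
  ext i
  fin_cases i <;>
    simp [Matrix.mulVec, dotProduct, Fin.sum_univ_two, Matrix.trace_fin_two,
      Matrix.det_fin_two] <;>
    ring

/-- Any solution of `m^{n+1} = E m^n` (with `E ∈ M₂(R)`) satisfies the two-step vector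
recursion `m^{n+2} = tr(E) m^{n+1} − det(E) m^n`; consequently, if `Ẽ` has the same trace
and determinant as `E`, then solutions of the two schemes whose conserved (first)
components agree at times `0` and `1` have identical conserved components for all times. -/
theorem stmt_12 {R : Type*} [CommRing R] (E : Matrix (Fin 2) (Fin 2) R) :
    (∀ m : ℕ → Fin 2 → R, (∀ n, m (n + 1) = E *ᵥ m n) →
      ∀ n, m (n + 2) = E.trace • m (n + 1) - E.det • m n) ∧
    (∀ E' : Matrix (Fin 2) (Fin 2) R, E'.trace = E.trace → E'.det = E.det →
      ∀ m m' : ℕ → Fin 2 → R,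
        (∀ n, m (n + 1) = E *ᵥ m n) → (∀ n, m' (n + 1) = E' *ᵥ m' n) →
        m 0 0 = m' 0 0 → m 1 0 = m' 1 0 → ∀ n, m n 0 = m' n 0) := by
  refine ⟨fun m hm => orbit_two_step_recursion hm, ?_⟩
  intro E' htr hdet m m' hm hm' h0 h1 n
  induction n using Nat.twoStepInduction with
  | zero => exact h0
  | one => exact h1
  | more n ih ih' =>
    rw [orbit_two_step_recursion hm, orbit_two_step_recursion hm', htr, hdet]
    simp [ih, ih']
end
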